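/- Let G be a simple graph on a finite vertex set V with injective labeling id : V → ℕ, and run the deterministic MIS iteration A₀ = ∅, P₀ = V, A_{k+1} = A_k ∪ T(P_k), P_{k+1} = P_k \ (T(P_k) ∪ N(T(P_k))). If P_k = ∅ for some k, then A_k is a maximal independent set of G: A_k is independent and every vertex of V \ A_k is adjacent to some vertex of A_k. -/

import Mathlib

variable {V : Type*} [Fintype V] [DecidableEq V]

/-- The locally minimal set `T(P) = {v ∈ P : id v ≤ id u for all u ∈ N(v) ∩ P}`. -/
def misT (G : SimpleGraph V) [DecidableRel G.Adj] (id : V → ℕ) (P : Finset V) :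
    Finset V :=
  P.filter fun v => ∀ u ∈ P, G.Adj v u → id v ≤ id u

/-- The neighborhood `N(S) = ⋃_{v∈S} N(v)` of a set of vertices. -/
def misN (G : SimpleGraph V) [DecidableRel G.Adj] (S : Finset V) : Finset V :=
  S.biUnion fun v => G.neighborFinset v

/-- The deterministic MIS iteration: `A₀ = ∅`, `P₀ = V`,
`A_{k+1} = A_k ∪ T(P_k)`, `P_{k+1} = P_k \ (T(P_k) ∪ N(T(P_k)))`. -/
def misIter (G : SimpleGraph V) [DecidableRel G.Adj] (id : V → ℕ) :
    ℕ → Finset V × Finset V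
  | 0 => (∅, Finset.univ)
  | k + 1 =>
    let AP := misIter G id k
    (AP.1 ∪ misT G id AP.2, AP.2 \ (misT G id AP.2 ∪ misN G (misT G id AP.2)))

theorem not_adj_of_mem_misT (G : SimpleGraph V) [DecidableRel G.Adj] {id : V → ℕ}
    (hid : Function.Injective id) {P : Finset V} {v w : V}
    (hv : v ∈ misT G id P) (hw : w ∈ misT G id P) : ¬ G.Adj v w := by
  intro hvw
  simp only [misT, Finset.mem_filter] at hv hw
  exact hvw.ne (hid (le_antisymm (hv.2 w hw.1 hvw) (hw.2 v hv.1 hvw.symm)))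

theorem mem_misN (G : SimpleGraph V) [DecidableRel G.Adj] {S : Finset V} {v : V} :
    v ∈ misN G S ↔ ∃ w ∈ S, G.Adj v w := by
  simp [misN, G.adj_comm v]

/-- The pool `P_k` consists of the vertices neither in `A_k` nor adjacent to it. -/
theorem mem_misIter_snd (G : SimpleGraph V) [DecidableRel G.Adj] (id : V → ℕ) (k : ℕ) (v : V) :
    v ∈ (misIter G id k).2 ↔
      v ∉ (misIter G id k).1 ∧ ∀ w ∈ (misIter G id k).1, ¬ G.Adj v w := by
  induction k with
  | zero => simp [misIter]
  | succ k ih =>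
    simp only [misIter, Finset.mem_sdiff, Finset.mem_union, mem_misN, ih]
    grind

theorem misIter_fst_independent (G : SimpleGraph V) [DecidableRel G.Adj] {id : V → ℕ}
    (hid : Function.Injective id) (k : ℕ) :
    ∀ v ∈ (misIter G id k).1, ∀ w ∈ (misIter G id k).1, ¬ G.Adj v w := by
  induction k with
  | zero => simp [misIter]
  | succ k ih =>
    have not_adj {v w : V} (hv : v ∈ misT G id (misIter G id k).2)
        (hw : w ∈ (misIter G id k).1) : ¬ G.Adj v w :=
      ((mem_misIter_snd G id k v).1 (Finset.filter_subset _ _ hv)).2 w hw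
    intro v hv w hw
    simp only [misIter, Finset.mem_union] at hv hw
    rcases hv with hv | hv <;> rcases hw with hw | hw
    · exact ih v hv w hw
    · exact fun hvw => not_adj hw hv hvw.symm
    · exact not_adj hv hw
    · exact not_adj_of_mem_misT G hid hv hw

/-- If `P_k = ∅` then `A_k` is a maximal independent set of `G`: it is
independent, and every vertex outside `A_k` is adjacent to some vertex of `A_k`. -/
theorem misIter_terminates_with_maximal_independent_set
    (G : SimpleGraph V) [DecidableRel G.Adj] (id : V → ℕ)
    (hid : Function.Injective id) (k : ℕ) (h : (misIter G id k).2 = ∅) :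
    (∀ v ∈ (misIter G id k).1, ∀ w ∈ (misIter G id k).1, ¬ G.Adj v w) ∧
      (∀ v : V, v ∉ (misIter G id k).1 → ∃ w ∈ (misIter G id k).1, G.Adj v w) := by
  refine ⟨misIter_fst_independent G hid k, fun v hv => ?_⟩
  by_contra! hadj
  have hmem := (mem_misIter_snd G id k v).2 ⟨hv, hadj⟩
  simp [h] at hmem
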